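/- Let τ ∈ P^{1/2}_φ(M) and set s_n = (1/n) ∑_{k=0}^{n−1} τ^k for n ≥ 1. Then each s_n ∈ P^{1/2}_φ(M), and there exists a map E ∈ P^{1/2}_φ(M) such that: E ∘ τ = τ ∘ E = E, E ∘ E = E, E(x) ∈ N for every x ∈ M and E(x) = x for every x ∈ N, where N = {x ∈ M : τ(x) = x}; and for all f, g ∈ H, sup_{x ∈ M, ‖x‖ ≤ 1} |⟨f, (s_n(x) − E(x)) g⟩| → 0 as n → ∞. -/

import Mathlib

open scoped ComplexOrder
open Filter Topology

noncomputable section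

local notation "⟪" x ", " y "⟫" => @inner ℂ _ _ x y

variable {H : Type*} [NormedAddCommGroup H] [InnerProductSpace ℂ H] [CompleteSpace H]

/-- `ζ` is a cyclic vector for the von Neumann algebra `M`. -/
def IsCyclicVector (M : VonNeumannAlgebra H) (ζ : H) : Prop :=
  Dense (Submodule.span ℂ {v : H | ∃ x ∈ M, v = x ζ} : Set H)

/-- `ζ` is a separating vector for the von Neumann algebra `M`. -/
def IsSeparatingVector (M : VonNeumannAlgebra H) (ζ : H) : Prop :=
  ∀ x ∈ M, x ζ = 0 → x = 0

/-- `τ` maps `M` into `M` and takes positive elements of `M` to positive operators. -/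
def IsPositiveMapOn (M : VonNeumannAlgebra H)
    (τ : (H →L[ℂ] H) →ₗ[ℂ] (H →L[ℂ] H)) : Prop :=
  (∀ x ∈ M, τ x ∈ M) ∧ ∀ x ∈ M, x.IsPositive → (τ x).IsPositive

/-- Membership in `P^{1/2}_φ(M)` where `φ = ⟨ζ, · ζ⟩`: a positive map on `M` with
`τ(1) ≤ 1`, `φ ∘ τ ≤ φ` on positive elements, and `‖τ(x)ζ‖ ≤ ‖xζ‖`. -/
def MemPHalf (M : VonNeumannAlgebra H) (ζ : H)
    (τ : (H →L[ℂ] H) →ₗ[ℂ] (H →L[ℂ] H)) : Prop :=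
  IsPositiveMapOn M τ ∧ ((1 : H →L[ℂ] H) - τ 1).IsPositive ∧
    (∀ x ∈ M, x.IsPositive → ⟪ζ, τ x ζ⟫ ≤ ⟪ζ, x ζ⟫) ∧
    ∀ x ∈ M, ‖τ x ζ‖ ≤ ‖x ζ‖

/-- The ergodic averages `s_n = (1/n) ∑_{k=0}^{n-1} τ^k` of an operator map `τ`. -/
def ergAvg (τ : Module.End ℂ (H →L[ℂ] H)) (n : ℕ) : Module.End ℂ (H →L[ℂ] H) :=
  (n : ℂ)⁻¹ • ∑ k ∈ Finset.range n, τ ^ k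

open ContinuousLinearMap

namespace VonNeumannAlgebra

theorem smul_mem (M : VonNeumannAlgebra H) (c : ℂ) {x : H →L[ℂ] H} (hx : x ∈ M) : c • x ∈ M :=
  M.toStarSubalgebra.smul_mem hx c

theorem apply_commutant_apply {M : VonNeumannAlgebra H} {x y : H →L[ℂ] H} (hx : x ∈ M)
    (hy : y ∈ M.commutant) (g : H) : x (y g) = y (x g) :=
  DFunLike.congr_fun (mem_commutant_iff.mp hy x hx) g

/-- A von Neumann algebra is closed under pointwise limits. -/
theorem mem_of_tendsto (M : VonNeumannAlgebra H) {T : ℕ → H →L[ℂ] H} {S : H →L[ℂ] H}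
    (hT : ∀ n, T n ∈ M) (h : ∀ g, Tendsto (fun n ↦ T n g) atTop (𝓝 (S g))) : S ∈ M := by
  rw [← M.commutant_commutant, mem_commutant_iff]
  intro y hy
  ext g
  refine tendsto_nhds_unique ((y.continuous.tendsto _).comp (h g)) ((h (y g)).congr fun n ↦ ?_)
  exact apply_commutant_apply (hT n) hy g

end VonNeumannAlgebra

/-- A separating vector of a von Neumann algebra is cyclic for the commutant. -/
theorem IsSeparatingVector.dense_commutant {M : VonNeumannAlgebra H} {ζ : H}
    (hsep : IsSeparatingVector M ζ) (g : H) {δ : ℝ} (hδ : 0 < δ) :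
    ∃ y ∈ M.commutant, ‖g - y ζ‖ < δ := by
  let L : Submodule ℂ H := (Subalgebra.toSubmodule M.commutant.toStarSubalgebra.toSubalgebra).map
    (ContinuousLinearMap.apply ℂ H ζ : (H →L[ℂ] H) →ₗ[ℂ] H)
  have hL {v : H} : v ∈ L ↔ ∃ y ∈ M.commutant, y ζ = v := Iff.rfl
  let K := L.topologicalClosure
  have : CompleteSpace K := L.isClosed_topologicalClosure.completeSpace_coe
  have hζ : ζ ∈ K := L.le_topologicalClosure (hL.mpr ⟨1, one_mem _, rfl⟩)
  have hp : K.starProjection ∈ M := by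
    rw [VonNeumannAlgebra.IsStarProjection.mem_iff isStarProjection_starProjection]
    intro y hy
    rw [Submodule.range_starProjection]
    refine fun v hv ↦ ?_
    refine map_mem_closure y.continuous hv fun w hw ↦ ?_
    obtain ⟨z, hz, rfl⟩ := hL.mp hw
    exact hL.mpr ⟨y * z, mul_mem hy hz, rfl⟩
  have h1 : (1 : H →L[ℂ] H) - K.starProjection = 0 := by
    refine hsep _ (sub_mem (one_mem M) hp) ?_
    simp [Submodule.starProjection_eq_self_iff.mpr hζ]
  have hg : g ∈ K := by
    rw [← Submodule.starProjection_eq_self_iff]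
    exact (DFunLike.congr_fun (sub_eq_zero.mp h1) g).symm
  obtain ⟨v, hv, hgv⟩ := Metric.mem_closure_iff.mp hg δ hδ
  obtain ⟨y, hy, rfl⟩ := hL.mp hv
  exact ⟨y, hy, by rwa [← dist_eq_norm]⟩

/-- A bounded sequence in a von Neumann algebra that converges at a separating vector converges
pointwise to an element of the algebra. -/
theorem IsSeparatingVector.exists_tendsto {M : VonNeumannAlgebra H} {ζ v : H}
    (hsep : IsSeparatingVector M ζ) {T : ℕ → H →L[ℂ] H} (hT : ∀ n, T n ∈ M) {C : ℝ}
    (hC : ∀ n, ‖T n‖ ≤ C) (hv : Tendsto (fun n ↦ T n ζ) atTop (𝓝 v)) :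
    ∃ S ∈ M, ∀ g, Tendsto (fun n ↦ T n g) atTop (𝓝 (S g)) := by
  have hC0 : 0 ≤ C := (norm_nonneg _).trans (hC 0)
  have key (g : H) : CauchySeq fun n ↦ T n g := by
    rw [Metric.cauchySeq_iff']
    intro ε hε
    obtain ⟨y, hy, hgy⟩ := hsep.dense_commutant g (δ := ε / (4 * (C + 1))) (by positivity)
    have hgy' : C * ‖g - y ζ‖ ≤ ε / 4 := by
      calc C * ‖g - y ζ‖ ≤ (C + 1) * (ε / (4 * (C + 1))) := by gcongr; linarith
        _ = ε / 4 := by field_simp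
    have hcomm (n) : T n (y ζ) = y (T n ζ) :=
      VonNeumannAlgebra.apply_commutant_apply (hT n) hy ζ
    have hc : CauchySeq fun n ↦ T n (y ζ) := by
      simp only [hcomm]
      exact ((y.continuous.tendsto v).comp hv).cauchySeq
    obtain ⟨N, hN⟩ := Metric.cauchySeq_iff'.mp hc (ε / 2) (by positivity)
    have hd (n) : dist (T n g) (T n (y ζ)) ≤ ε / 4 := by
      rw [dist_eq_norm, ← map_sub]
      exact ((T n).le_of_opNorm_le (hC n) _).trans hgy'
    refine ⟨N, fun n hn ↦ ?_⟩
    have h1 := hd n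
    have h2 := hd N
    have h3 := hN n hn
    rw [dist_comm] at h2
    linarith [dist_triangle4 (T n g) (T n (y ζ)) (T N (y ζ)) (T N g)]
  choose F hF using fun g ↦ cauchySeq_tendsto_of_complete (key g)
  let S : H →L[ℂ] H := continuousLinearMapOfTendsto T (tendsto_pi_nhds.mpr hF)
  exact ⟨S, M.mem_of_tendsto hT hF, hF⟩

set_option linter.unusedSectionVars false in
theorem ContinuousLinearMap.isPositive_of_tendsto {T : ℕ → H →L[ℂ] H} {S : H →L[ℂ] H}
    (hT : ∀ᶠ n in atTop, (T n).IsPositive) (h : ∀ g, Tendsto (fun n ↦ T n g) atTop (𝓝 (S g))) :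
    S.IsPositive := by
  rw [isPositive_def]
  refine ⟨fun g h' ↦ ?_, fun g ↦ ?_⟩
  · refine tendsto_nhds_unique_of_eventuallyEq ((h g).inner tendsto_const_nhds)
      (tendsto_const_nhds.inner (h h')) ?_
    filter_upwards [hT] with n hn using hn.isSymmetric g h'
  · refine ge_of_tendsto ((Complex.continuous_re.tendsto _).comp
      ((h g).inner tendsto_const_nhds)) ?_
    filter_upwards [hT] with n hn using hn.re_inner_nonneg_left g

namespace MemPHalf

variable {M : VonNeumannAlgebra H} {ζ : H}

theorem one : MemPHalf M ζ (1 : Module.End ℂ (H →L[ℂ] H)) :=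
  ⟨⟨fun _ h ↦ h, fun _ _ h ↦ h⟩, by simp, fun _ _ _ ↦ le_rfl, fun _ _ ↦ le_rfl⟩

theorem mul {σ τ : Module.End ℂ (H →L[ℂ] H)} (hσ : MemPHalf M ζ σ) (hτ : MemPHalf M ζ τ) :
    MemPHalf M ζ (σ * τ) := by
  refine ⟨⟨fun x hx ↦ hσ.1.1 _ (hτ.1.1 x hx),
    fun x hx hp ↦ hσ.1.2 _ (hτ.1.1 x hx) (hτ.1.2 x hx hp)⟩, ?_, fun x hx hp ↦
    (hσ.2.2.1 _ (hτ.1.1 x hx) (hτ.1.2 x hx hp)).trans (hτ.2.2.1 x hx hp), fun x hx ↦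
    (hσ.2.2.2 _ (hτ.1.1 x hx)).trans (hτ.2.2.2 x hx)⟩
  have h := hσ.2.1.add
    (hσ.1.2 (1 - τ 1) (sub_mem (one_mem M) (hτ.1.1 1 (one_mem M))) hτ.2.1)
  simpa using! h

theorem pow {τ : Module.End ℂ (H →L[ℂ] H)} (hτ : MemPHalf M ζ τ) (n : ℕ) :
    MemPHalf M ζ (τ ^ n) := by
  induction n with
  | zero => exact one
  | succ n ih => rw [pow_succ]; exact ih.mul hτ

set_option linter.unusedSectionVars false in
theorem ergAvg_apply (τ : Module.End ℂ (H →L[ℂ] H)) (n : ℕ) (x : H →L[ℂ] H) :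
    ergAvg τ n x = (n : ℂ)⁻¹ • ∑ k ∈ Finset.range n, (τ ^ k) x := by
  simp [ergAvg]

set_option linter.unusedSectionVars false in
theorem sub_ergAvg_apply (τ : Module.End ℂ (H →L[ℂ] H)) {n : ℕ} (hn : 1 ≤ n) (x : H →L[ℂ] H) :
    x - ergAvg τ n x = (n : ℂ)⁻¹ • ∑ k ∈ Finset.range n, (x - (τ ^ k) x) := by
  have hn' : (n : ℂ) ≠ 0 := by exact_mod_cast (by omega : n ≠ 0)
  rw [ergAvg_apply, Finset.sum_sub_distrib, smul_sub, Finset.sum_const, Finset.card_range,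
    ← Nat.cast_smul_eq_nsmul ℂ, smul_smul, inv_mul_cancel₀ hn', one_smul]

theorem ergAvg_mem {τ : Module.End ℂ (H →L[ℂ] H)} (hτ : MemPHalf M ζ τ) (n : ℕ)
    {x : H →L[ℂ] H} (hx : x ∈ M) : ergAvg τ n x ∈ M := by
  rw [ergAvg_apply]
  exact M.smul_mem _ (sum_mem fun k _ ↦ (hτ.pow k).1.1 x hx)

theorem memPHalf_ergAvg {τ : Module.End ℂ (H →L[ℂ] H)} (hτ : MemPHalf M ζ τ) {n : ℕ} (hn : 1 ≤ n) :
    MemPHalf M ζ (ergAvg τ n) := by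
  have hinv : (0 : ℂ) ≤ (n : ℂ)⁻¹ := by positivity
  have hn' : (n : ℝ) ≠ 0 := by exact_mod_cast (by omega : n ≠ 0)
  refine ⟨⟨fun x hx ↦ hτ.ergAvg_mem n hx, fun x hx hp ↦ ?_⟩, ?_, fun x hx hp ↦ ?_,
    fun x hx ↦ ?_⟩
  · rw [ergAvg_apply]
    exact (isPositive_sum _ fun k _ ↦ (hτ.pow k).1.2 x hx hp).smul_of_nonneg hinv
  · rw [sub_ergAvg_apply τ hn]
    exact (isPositive_sum _ fun k _ ↦ (hτ.pow k).2.1).smul_of_nonneg hinv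
  · rw [← sub_nonneg, ← inner_sub_right, ← sub_apply, sub_ergAvg_apply τ hn, smul_apply, sum_apply,
      inner_smul_right, inner_sum]
    refine mul_nonneg hinv (Finset.sum_nonneg fun k _ ↦ ?_)
    rw [sub_apply, inner_sub_right, sub_nonneg]
    exact (hτ.pow k).2.2.1 x hx hp
  · rw [ergAvg_apply, smul_apply, sum_apply, norm_smul, norm_inv, Complex.norm_natCast]
    calc (n : ℝ)⁻¹ * ‖∑ k ∈ Finset.range n, (τ ^ k) x ζ‖
        ≤ (n : ℝ)⁻¹ * (Finset.range n).card • ‖x ζ‖ := by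
          gcongr
          exact (norm_sum_le _ _).trans
            (Finset.sum_le_card_nsmul _ _ _ fun k _ ↦ (hτ.pow k).2.2.2 x hx)
      _ = ‖x ζ‖ := by
        rw [Finset.card_range, nsmul_eq_mul, inv_mul_cancel_left₀ hn']

theorem norm_apply_le_of_isSelfAdjoint {σ : (H →L[ℂ] H) →ₗ[ℂ] (H →L[ℂ] H)}
    (hσ : MemPHalf M ζ σ) {x : H →L[ℂ] H} (hx : x ∈ M) (hsa : IsSelfAdjoint x) :
    ‖σ x‖ ≤ 2 * ‖x‖ := by
  set r : H →L[ℂ] H := ((‖x‖ : ℝ) : ℂ) • 1 with hr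
  have hrM : r ∈ M := M.smul_mem _ (one_mem M)
  have hr' : algebraMap ℝ (H →L[ℂ] H) ‖x‖ = r := by
    rw [hr, Algebra.algebraMap_eq_smul_one, Complex.coe_smul]
  have h1 : 0 ≤ σ (r - x) := by
    rw [nonneg_iff_isPositive]
    refine hσ.1.2 _ (sub_mem hrM hx) ?_
    rw [← ContinuousLinearMap.le_def, ← hr']
    exact hsa.le_algebraMap_norm_self
  have h2 : 0 ≤ σ (r + x) := by
    rw [nonneg_iff_isPositive]
    refine hσ.1.2 _ (add_mem hrM hx) ?_
    rw [← nonneg_iff_isPositive, ← neg_le_iff_add_nonneg', ← hr']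
    exact hsa.neg_algebraMap_norm_le_self
  have h3 : σ r ≤ r := by
    rw [ContinuousLinearMap.le_def, hr, map_smul, ← smul_sub]
    exact hσ.2.1.smul_of_nonneg (by positivity)
  have hle {a : H →L[ℂ] H} (ha : 0 ≤ a) (h : a ≤ r + r) : ‖a‖ ≤ 2 * ‖x‖ := by
    refine (CStarAlgebra.norm_le_norm_of_nonneg_of_le ha h).trans ?_
    have : ‖r‖ ≤ ‖x‖ := by
      rw [hr, norm_smul, Complex.norm_real, norm_norm]
      exact mul_le_of_le_one_right (norm_nonneg _) norm_id_le
    linarith [norm_add_le r r]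
  have hsum : σ (r - x) + σ (r + x) ≤ r + r := by
    rw [← map_add, sub_add_add_cancel, map_add]
    exact add_le_add h3 h3
  have h4 := hle h1 ((le_add_of_nonneg_right h2).trans hsum)
  have h5 := hle h2 ((le_add_of_nonneg_left h1).trans hsum)
  have h6 : (2 : ℂ) • σ x = σ (r + x) - σ (r - x) := by
    rw [← map_sub, ← map_smul]; congr 1; module
  have h7 : 2 * ‖σ x‖ = ‖σ (r + x) - σ (r - x)‖ := by
    rw [← h6, norm_smul]; simp
  linarith [norm_sub_le (σ (r + x)) (σ (r - x))]

theorem norm_apply_le {σ : (H →L[ℂ] H) →ₗ[ℂ] (H →L[ℂ] H)} (hσ : MemPHalf M ζ σ)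
    {x : H →L[ℂ] H} (hx : x ∈ M) : ‖σ x‖ ≤ 4 * ‖x‖ := by
  have hre : (realPart x : H →L[ℂ] H) ∈ M := by
    rw [realPart_apply_coe, ← Complex.coe_smul]
    exact M.smul_mem _ (add_mem hx (star_mem hx))
  have him : (imaginaryPart x : H →L[ℂ] H) ∈ M := by
    rw [imaginaryPart_apply_coe, ← Complex.coe_smul]
    exact M.smul_mem _ (M.smul_mem _ (sub_mem hx (star_mem hx)))
  have h1 := hσ.norm_apply_le_of_isSelfAdjoint hre (realPart x).2
  have h2 := hσ.norm_apply_le_of_isSelfAdjoint him (imaginaryPart x).2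
  have h3 : ‖(realPart x : H →L[ℂ] H)‖ ≤ ‖x‖ := realPart.norm_le x
  have h4 : ‖(imaginaryPart x : H →L[ℂ] H)‖ ≤ ‖x‖ := imaginaryPart.norm_le x
  calc ‖σ x‖ = ‖σ (realPart x) + Complex.I • σ (imaginaryPart x)‖ := by
        rw [← map_smul, ← map_add, realPart_add_I_smul_imaginaryPart]
    _ ≤ ‖σ (realPart x)‖ + ‖σ (imaginaryPart x)‖ := by
        refine (norm_add_le _ _).trans ?_
        simp [norm_smul]
    _ ≤ 4 * ‖x‖ := by linarith

/-- The contraction of `H` induced by a map in `P^{1/2}_φ(M)`. -/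
theorem exists_contraction (hcyc : IsCyclicVector M ζ) {τ : (H →L[ℂ] H) →ₗ[ℂ] (H →L[ℂ] H)}
    (hτ : MemPHalf M ζ τ) : ∃ V : H →L[ℂ] H, ‖V‖ ≤ 1 ∧ ∀ x ∈ M, V (x ζ) = τ x ζ := by
  let A : Submodule ℂ (H →L[ℂ] H) := Subalgebra.toSubmodule M.toStarSubalgebra.toSubalgebra
  let ev : (H →L[ℂ] H) →ₗ[ℂ] H := (ContinuousLinearMap.apply ℂ H ζ : (H →L[ℂ] H) →L[ℂ] H)
  let e : A →ₗ[ℂ] H := ev ∘ₗ A.subtype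
  let f : A →ₗ[ℂ] H := ev ∘ₗ τ ∘ₗ A.subtype
  have he : DenseRange e := by
    refine hcyc.mono ?_
    have : Submodule.span ℂ {v : H | ∃ x ∈ M, v = x ζ} ≤ LinearMap.range e := by
      rw [Submodule.span_le]
      rintro _ ⟨x, hx, rfl⟩
      exact ⟨⟨x, hx⟩, rfl⟩
    exact this
  have hf (x : A) : ‖f x‖ ≤ 1 * ‖e x‖ := by
    rw [one_mul]
    exact hτ.2.2.2 x x.2
  exact ⟨f.extendOfNorm e, LinearMap.opNorm_extendOfNorm_le he zero_le_one hf,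
    fun x hx ↦ LinearMap.extendOfNorm_eq he ⟨1, hf⟩ ⟨x, hx⟩⟩

theorem pow_apply_eq_iterate {τ : Module.End ℂ (H →L[ℂ] H)} (hτ : MemPHalf M ζ τ)
    {V : H →L[ℂ] H} (hV : ∀ x ∈ M, V (x ζ) = τ x ζ) (k : ℕ) {x : H →L[ℂ] H} (hx : x ∈ M) :
    (τ ^ k) x ζ = V^[k] (x ζ) := by
  induction k with
  | zero => rfl
  | succ k ih =>
    rw [Function.iterate_succ_apply', ← ih, hV _ ((hτ.pow k).1.1 x hx), pow_succ']
    rfl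

theorem ergAvg_apply_vector {τ : Module.End ℂ (H →L[ℂ] H)} (hτ : MemPHalf M ζ τ)
    {V : H →L[ℂ] H} (hV : ∀ x ∈ M, V (x ζ) = τ x ζ) (n : ℕ) {x : H →L[ℂ] H} (hx : x ∈ M) :
    ergAvg τ n x ζ = birkhoffAverage ℂ V _root_.id n (x ζ) := by
  rw [ergAvg_apply, smul_apply, sum_apply, birkhoffAverage, birkhoffSum]
  congr 1
  exact Finset.sum_congr rfl fun k _ ↦ hτ.pow_apply_eq_iterate hV k hx

/-- The ergodic averages of an element of `M` converge pointwise. -/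
theorem exists_tendsto_ergAvg (hcyc : IsCyclicVector M ζ) (hsep : IsSeparatingVector M ζ)
    {τ : Module.End ℂ (H →L[ℂ] H)} (hτ : MemPHalf M ζ τ) {x : H →L[ℂ] H} (hx : x ∈ M) :
    ∃ S ∈ M, ∀ g, Tendsto (fun n ↦ ergAvg τ n x g) atTop (𝓝 (S g)) := by
  obtain ⟨V, hV1, hV⟩ := hτ.exists_contraction hcyc
  have hv := V.tendsto_birkhoffAverage_orthogonalProjection hV1 (x ζ)
  simp only [← hτ.ergAvg_apply_vector hV _ hx] at hv
  refine hsep.exists_tendsto (T := fun n ↦ ergAvg τ n x) (fun n ↦ hτ.ergAvg_mem n hx)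
    (C := 4 * ‖x‖) (fun n ↦ ?_) hv
  rcases Nat.eq_zero_or_pos n with rfl | hn
  · simp [ergAvg]
  · exact (hτ.memPHalf_ergAvg hn).norm_apply_le hx

set_option linter.unusedSectionVars false in
/-- A pointwise limit of linear maps on a subspace of operators extends to a linear map. -/
theorem exists_linearMap_of_tendsto (A : Submodule ℂ (H →L[ℂ] H))
    (s : ℕ → (H →L[ℂ] H) →ₗ[ℂ] (H →L[ℂ] H)) (F : A → (H →L[ℂ] H))
    (hF : ∀ x : A, ∀ g, Tendsto (fun n ↦ s n x g) atTop (𝓝 (F x g))) :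
    ∃ E : (H →L[ℂ] H) →ₗ[ℂ] (H →L[ℂ] H), ∀ x : A, E x = F x := by
  let E₀ : A →ₗ[ℂ] (H →L[ℂ] H) :=
    { toFun := F
      map_add' := fun x y ↦ by
        ext g
        refine tendsto_nhds_unique (hF (x + y) g) (((hF x g).add (hF y g)).congr fun n ↦ ?_)
        rw [Submodule.coe_add, map_add, add_apply]
      map_smul' := fun c x ↦ by
        ext g
        refine tendsto_nhds_unique (hF (c • x) g) (((hF x g).const_smul c).congr fun n ↦ ?_)
        rw [Submodule.coe_smul, map_smul, smul_apply] }
  obtain ⟨E, hE⟩ := LinearMap.exists_extend E₀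
  exact ⟨E, LinearMap.congr_fun hE⟩

/-- The pointwise limit of the ergodic averages, as a linear map. -/
theorem exists_limit (hcyc : IsCyclicVector M ζ) (hsep : IsSeparatingVector M ζ)
    {τ : Module.End ℂ (H →L[ℂ] H)} (hτ : MemPHalf M ζ τ) :
    ∃ E : (H →L[ℂ] H) →ₗ[ℂ] (H →L[ℂ] H), ∀ x ∈ M, E x ∈ M ∧
      ∀ g, Tendsto (fun n ↦ ergAvg τ n x g) atTop (𝓝 (E x g)) := by
  let A : Submodule ℂ (H →L[ℂ] H) := Subalgebra.toSubmodule M.toStarSubalgebra.toSubalgebra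
  have key (x : A) := hτ.exists_tendsto_ergAvg hcyc hsep (x := x) x.2
  choose F hFM hF using key
  obtain ⟨E, hE⟩ := exists_linearMap_of_tendsto A (ergAvg τ) F hF
  refine ⟨E, fun x hx ↦ ?_⟩
  rw [hE ⟨x, hx⟩]
  exact ⟨hFM _, hF ⟨x, hx⟩⟩

theorem of_tendsto {τ E : Module.End ℂ (H →L[ℂ] H)} (hτ : MemPHalf M ζ τ)
    (hE : ∀ x ∈ M, E x ∈ M ∧
      ∀ g, Tendsto (fun n ↦ ergAvg τ n x g) atTop (𝓝 (E x g))) :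
    MemPHalf M ζ E := by
  have hev : ∀ᶠ n : ℕ in atTop, MemPHalf M ζ (ergAvg τ n) := by
    filter_upwards [eventually_ge_atTop 1] with n hn using hτ.memPHalf_ergAvg hn
  refine ⟨⟨fun x hx ↦ (hE x hx).1, fun x hx hp ↦ ?_⟩, ?_, fun x hx hp ↦ ?_, fun x hx ↦ ?_⟩
  · refine isPositive_of_tendsto ?_ (hE x hx).2
    filter_upwards [hev] with n hn using hn.1.2 x hx hp
  · refine isPositive_of_tendsto (T := fun n ↦ 1 - ergAvg τ n 1) ?_
      fun g ↦ tendsto_const_nhds.sub ((hE 1 (one_mem M)).2 g)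
    filter_upwards [hev] with n hn using hn.2.1
  · refine le_of_tendsto (tendsto_const_nhds.inner ((hE x hx).2 ζ)) ?_
    filter_upwards [hev] with n hn using hn.2.2.1 x hx hp
  · refine le_of_tendsto ((hE x hx).2 ζ).norm ?_
    filter_upwards [hev] with n hn using hn.2.2.2 x hx

end MemPHalf

theorem ContinuousLinearMap.inner_birkhoffAverage (V : H →L[ℂ] H) (n : ℕ) (h v : H) :
    ⟪h, birkhoffAverage ℂ V _root_.id n v⟫ =
      ⟪birkhoffAverage ℂ (adjoint V) _root_.id n h, v⟫ := by
  have hk (k : ℕ) : ∀ h v, ⟪h, V^[k] v⟫ = ⟪(adjoint V)^[k] h, v⟫ := by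
    induction k with
    | zero => exact fun _ _ ↦ rfl
    | succ k ih =>
      intro h v
      rw [Function.iterate_succ_apply', Function.iterate_succ_apply, ← adjoint_inner_left, ih]
  simp [birkhoffAverage, birkhoffSum, hk, mul_comm]

namespace MemPHalf

variable {M : VonNeumannAlgebra H} {ζ : H}

/-- The ergodic averages converge to their pointwise limit weakly, uniformly on the unit ball. -/
theorem exists_forall_norm_inner_lt (hζ : ‖ζ‖ = 1) (hcyc : IsCyclicVector M ζ)
    (hsep : IsSeparatingVector M ζ) {τ E : Module.End ℂ (H →L[ℂ] H)} (hτ : MemPHalf M ζ τ)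
    (hE : ∀ x ∈ M, E x ∈ M ∧
      ∀ g, Tendsto (fun n ↦ ergAvg τ n x g) atTop (𝓝 (E x g)))
    (f g : H) {ε : ℝ} (hε : 0 < ε) :
    ∃ N : ℕ, ∀ n ≥ N, ∀ x ∈ M, ‖x‖ ≤ 1 → ‖⟪f, (ergAvg τ n x - E x) g⟫‖ < ε := by
  obtain ⟨V, hV1, hV⟩ := hτ.exists_contraction hcyc
  obtain ⟨y, hy, hgy⟩ := hsep.dense_commutant g (δ := ε / (16 * (‖f‖ + 1))) (by positivity)
  set h := adjoint y f
  have hV1' : ‖adjoint V‖ ≤ 1 := by rwa [LinearIsometryEquiv.norm_map]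
  obtain ⟨a, hlim⟩ : ∃ a, Tendsto (birkhoffAverage ℂ (adjoint V) _root_.id · h) atTop (𝓝 a) :=
    ⟨_, (adjoint V).tendsto_birkhoffAverage_orthogonalProjection hV1' h⟩
  obtain ⟨N, hN⟩ := Metric.tendsto_atTop.mp hlim (ε / 2) (by positivity)
  refine ⟨max N 1, fun n hn x hx hx1 ↦ ?_⟩
  have havg (m) : ⟪h, ergAvg τ m x ζ⟫ =
      ⟪birkhoffAverage ℂ (adjoint V) _root_.id m h, x ζ⟫ := by
    rw [hτ.ergAvg_apply_vector hV m hx, inner_birkhoffAverage]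
  have hEa : ⟪h, E x ζ⟫ = ⟪a, x ζ⟫ :=
    tendsto_nhds_unique (tendsto_const_nhds.inner ((hE x hx).2 ζ))
      ((hlim.inner tendsto_const_nhds).congr fun m ↦ (havg m).symm)
  set D := ergAvg τ n x - E x with hD
  have hDM : D ∈ M := sub_mem (hτ.ergAvg_mem n hx) (hE x hx).1
  have hDn : ‖D‖ ≤ 8 := by
    have h1 := (hτ.memPHalf_ergAvg (le_of_max_le_right hn)).norm_apply_le hx
    have h2 := (hτ.of_tendsto hE).norm_apply_le hx
    linarith [norm_sub_le (ergAvg τ n x) (E x)]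
  have h1 : ‖⟪f, D (y ζ)⟫‖ < ε / 2 := by
    rw [VonNeumannAlgebra.apply_commutant_apply hDM hy, ← adjoint_inner_left, hD,
      sub_apply, inner_sub_right, havg, hEa, ← inner_sub_left]
    have hxζ : ‖x ζ‖ ≤ 1 := by simpa [hζ] using x.le_of_opNorm_le hx1 ζ
    have := hN n (le_of_max_le_left hn)
    rw [dist_eq_norm] at this
    exact ((norm_inner_le_norm _ _).trans (mul_le_of_le_one_right (norm_nonneg _) hxζ)).trans_lt
      this
  have h2 : ‖⟪f, D (g - y ζ)⟫‖ ≤ ε / 2 := by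
    calc ‖⟪f, D (g - y ζ)⟫‖ ≤ ‖f‖ * (8 * ‖g - y ζ‖) :=
          (norm_inner_le_norm _ _).trans (by gcongr; exact D.le_of_opNorm_le hDn _)
      _ ≤ (‖f‖ + 1) * (8 * (ε / (16 * (‖f‖ + 1)))) := by gcongr; linarith
      _ = ε / 2 := by field_simp; norm_num
  calc ‖⟪f, D g⟫‖ = ‖⟪f, D (g - y ζ)⟫ + ⟪f, D (y ζ)⟫‖ := by
        rw [← inner_add_right, ← map_add, sub_add_cancel]
    _ < ε := by linarith [norm_add_le ⟪f, D (g - y ζ)⟫ ⟪f, D (y ζ)⟫]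

end MemPHalf

theorem stmt5 (M : VonNeumannAlgebra H) (ζ : H) (hζ : ‖ζ‖ = 1)
    (hcyc : IsCyclicVector M ζ) (hsep : IsSeparatingVector M ζ)
    (τ : (H →L[ℂ] H) →ₗ[ℂ] (H →L[ℂ] H))
    (hτ : MemPHalf M ζ τ) :
    (∀ n : ℕ, 1 ≤ n → MemPHalf M ζ (ergAvg τ n)) ∧
    ∃ E : (H →L[ℂ] H) →ₗ[ℂ] (H →L[ℂ] H), MemPHalf M ζ E ∧
      (∀ x ∈ M, E (τ x) = E x) ∧
      (∀ x ∈ M, τ (E x) = E x) ∧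
      (∀ x ∈ M, E (E x) = E x) ∧
      (∀ x ∈ M, τ x = x → E x = x) ∧
      ∀ f g : H, ∀ ε > (0 : ℝ), ∃ N : ℕ, ∀ n ≥ N, ∀ x ∈ M, ‖x‖ ≤ 1 →
        ‖⟪f, (ergAvg τ n x - E x) g⟫‖ < ε := by
  refine ⟨fun n hn ↦ hτ.memPHalf_ergAvg hn, ?_⟩
  obtain ⟨E, hE⟩ := MemPHalf.exists_limit hcyc hsep hτ
  have hEP := MemPHalf.of_tendsto hτ hE
  obtain ⟨V, hV1, hV⟩ := hτ.exists_contraction hcyc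
  have hfix : ∀ x ∈ M, τ x = x → E x = x := by
    intro x hx h
    have hk (k : ℕ) : ((τ : Module.End ℂ (H →L[ℂ] H)) ^ k) x = x := by
      rw [Module.End.pow_apply]
      exact Function.iterate_fixed h k
    ext g
    refine tendsto_nhds_unique_of_eventuallyEq ((hE x hx).2 g) tendsto_const_nhds ?_
    filter_upwards [eventually_ge_atTop 1] with n hn
    have := MemPHalf.sub_ergAvg_apply τ hn x
    simp only [hk, sub_self, Finset.sum_const_zero, smul_zero] at this
    rw [← sub_eq_zero.mp this]
  have hEζ : ∀ x ∈ M, E x ζ =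
      (V.eqLocus (1 : H →L[ℂ] H)).orthogonalProjectionOnto (x ζ) := by
    intro x hx
    refine tendsto_nhds_unique ((hE x hx).2 ζ) ?_
    simp only [hτ.ergAvg_apply_vector hV _ hx]
    exact V.tendsto_birkhoffAverage_orthogonalProjection hV1 _
  have hτE : ∀ x ∈ M, τ (E x) = E x := by
    intro x hx
    rw [← sub_eq_zero]
    refine hsep _ (sub_mem (hτ.1.1 _ (hEP.1.1 x hx)) (hEP.1.1 x hx)) ?_
    rw [sub_apply, ← hV _ (hEP.1.1 x hx), hEζ x hx, sub_eq_zero]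
    exact ((V.eqLocus (1 : H →L[ℂ] H)).orthogonalProjectionOnto (x ζ)).2
  refine ⟨E, hEP, fun x hx ↦ ?_, hτE, fun x hx ↦ hfix _ (hEP.1.1 x hx) (hτE x hx), hfix,
    fun f g ε hε ↦ MemPHalf.exists_forall_norm_inner_lt hζ hcyc hsep hτ hE f g hε⟩
  rw [← sub_eq_zero]
  have hτx := hτ.1.1 x hx
  refine hsep _ (sub_mem (hEP.1.1 _ hτx) (hEP.1.1 x hx)) ?_
  refine tendsto_nhds_unique (((hE _ hτx).2 ζ).sub ((hE x hx).2 ζ)) ?_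
  simp only [hτ.ergAvg_apply_vector hV _ hx, hτ.ergAvg_apply_vector hV _ hτx, ← hV x hx]
  refine tendsto_birkhoffAverage_apply_sub_birkhoffAverage ℂ
    (isBounded_iff_forall_norm_le.2 ⟨‖x ζ‖, Set.forall_mem_range.2 fun k ↦ ?_⟩)
  rw [id_eq, ← hτ.pow_apply_eq_iterate hV k hx]
  exact (hτ.pow k).2.2.2 x hx
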